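/- For every integer j with 0 ≤ j < val(α) and every a ∈ ℚ_p, the function z ↦ z^j and the function z ↦ (αp/β)^{val(z−a)} (z−a)^{k−2−j} (extended by the value 0 at z = a) belong to B(α). -/

import Mathlib

open Filter Topology Classical

noncomputable section

namespace Paper

variable (p : ℕ) [Fact p.Prime]
variable (L : Type) [NontriviallyNormedField L] [NormedAlgebra ℚ_[p] L]

/-- The canonical embedding `ℚ_p → L`. -/
noncomputable def iotaL : ℚ_[p] → L := algebraMap ℚ_[p] L

/-- The binomial coefficient `binom(z, n) = z(z-1)⋯(z-n+1)/n!` of a `p`-adic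
integer, computed in `ℚ_p`. -/
noncomputable def binomQ (z : ℤ_[p]) (n : ℕ) : ℚ_[p] :=
  (∏ i ∈ Finset.range n, ((z : ℚ_[p]) - (i : ℚ_[p]))) / (n.factorial : ℚ_[p])

/-- The Mahler coefficients `a_n(f) = ∑_{i=0}^n (-1)^i binom(n,i) f(n-i)`. -/
noncomputable def mahlerCoeff (f : ℤ_[p] → L) (n : ℕ) : L :=
  ∑ i ∈ Finset.range (n + 1), (-1 : L) ^ i * (n.choose i : L) * f (((n - i : ℕ) : ℤ_[p]))

/-- `f : ℤ_p → L` is of class `C^r` : the scaled Mahler coefficients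
`n^r a_n(f)` tend to `0`, and `f` is the sum of its Mahler expansion. -/
def IsCr (r : ℝ) (f : ℤ_[p] → L) : Prop :=
  Tendsto (fun n : ℕ => (n : ℝ) ^ r * ‖mahlerCoeff p L f n‖) atTop (nhds 0) ∧
  ∀ z : ℤ_[p], HasSum (fun n : ℕ => mahlerCoeff p L f n * iotaL p L (binomQ p z n)) (f z)

/-- The norm `‖f‖_r = sup_n (n+1)^r ‖a_n(f)‖` on `C^r(ℤ_p, L)`. -/
noncomputable def crNorm (r : ℝ) (f : ℤ_[p] → L) : ℝ :=
  ⨆ n : ℕ, ((n : ℝ) + 1) ^ r * ‖mahlerCoeff p L f n‖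

/-- A continuous (= bounded) linear functional on `C^r(ℤ_p, L)`, i.e. a tempered
distribution of order `r`. -/
structure CrDual (r : ℝ) where
  toFun : (ℤ_[p] → L) → L
  map_add' : ∀ f g : ℤ_[p] → L, IsCr p L r f → IsCr p L r g →
    toFun (f + g) = toFun f + toFun g
  map_smul' : ∀ (c : L) (f : ℤ_[p] → L), IsCr p L r f → toFun (c • f) = c * toFun f
  bound' : ∃ C : ℝ, ∀ f : ℤ_[p] → L, IsCr p L r f → ‖toFun f‖ ≤ C * crNorm p L r f

/-- The function `z ↦ 1_{a + pⁿℤ_p}(z) (z - a)^j`. -/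
noncomputable def indPoly (a : ℤ_[p]) (n : ℕ) (j : ℕ) : ℤ_[p] → L := fun z =>
  if ‖z - a‖ ≤ (p : ℝ) ^ (-(n : ℤ)) then (iotaL p L ((z : ℚ_[p]) - (a : ℚ_[p]))) ^ j else 0

/-- The norm `‖μ‖_{r,d} = sup_{a, 0 ≤ j ≤ d, n} p^{n(j-r)} ‖∫_{a+pⁿℤ_p} (z-a)^j dμ‖`. -/
noncomputable def dualNormRD (r : ℝ) (d : ℕ) (μ : CrDual p L r) : ℝ :=
  ⨆ (a : ℤ_[p]) (j : Fin (d + 1)) (n : ℕ),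
    (p : ℝ) ^ ((n : ℝ) * (((j : ℕ) : ℝ) - r)) * ‖μ.toFun (indPoly p L a n j)‖

/-- `f : ℤ_p → L` is locally polynomial of local degree at most `d`. -/
def IsLocPoly (d : ℕ) (f : ℤ_[p] → L) : Prop :=
  ∃ n : ℕ, ∀ a : ℤ_[p], ∃ P : Polynomial L, P.natDegree ≤ d ∧
    ∀ z : ℤ_[p], ‖z - a‖ ≤ (p : ℝ) ^ (-(n : ℤ)) → f z = Polynomial.eval (iotaL p L (z : ℚ_[p])) P

/-- A linear functional on `Pol^d(ℤ_p, L)`. -/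
structure PolDual (d : ℕ) where
  toFun : (ℤ_[p] → L) → L
  map_add' : ∀ f g : ℤ_[p] → L, IsLocPoly p L d f → IsLocPoly p L d g →
    toFun (f + g) = toFun f + toFun g
  map_smul' : ∀ (c : L) (f : ℤ_[p] → L), IsLocPoly p L d f → toFun (c • f) = c * toFun f

/-- The valuation `val(x) = -log_p ‖x‖` on `L`, normalized by `val(p) = 1`. -/
noncomputable def valL (x : L) : ℝ := -Real.logb p ‖x‖

/-- `g : ℤ_p → L` is a class-`C^{val α}` extension of
`z ↦ (αp/β)^{val z} z^{k-2} f(1/z)` from `ℤ_p ∖ {0}` to `ℤ_p`. -/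
def Ext2 (k : ℕ) (α β : L) (f : ℚ_[p] → L) (g : ℤ_[p] → L) : Prop :=
  IsCr p L (valL p L α) g ∧ ∀ z : ℤ_[p], z ≠ 0 →
    g z = (α * (p : L) / β) ^ ((z : ℚ_[p]).valuation) *
      (iotaL p L (z : ℚ_[p])) ^ (k - 2) * f (((z : ℚ_[p]))⁻¹)

/-- Membership in the Banach space `B(α)`. -/
def MemB (k : ℕ) (α β : L) (f : ℚ_[p] → L) : Prop :=
  IsCr p L (valL p L α) (fun z : ℤ_[p] => f ((p : ℚ_[p]) * (z : ℚ_[p]))) ∧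
  ∃ g : ℤ_[p] → L, Ext2 p L k α β f g

/-- The extension `f₂` of `z ↦ (αp/β)^{val z} z^{k-2} f(1/z)` to `ℤ_p`
(it is unique when it exists). -/
noncomputable def ext2 (k : ℕ) (α β : L) (f : ℚ_[p] → L) : ℤ_[p] → L :=
  if h : ∃ g : ℤ_[p] → L, Ext2 p L k α β f g then h.choose else 0

/-- The norm `‖f‖ = max(‖f₁‖_{val α}, ‖f₂‖_{val α})` on `B(α)`. -/
noncomputable def bNorm (k : ℕ) (α β : L) (f : ℚ_[p] → L) : ℝ :=
  max (crNorm p L (valL p L α) (fun z : ℤ_[p] => f ((p : ℚ_[p]) * (z : ℚ_[p]))))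
      (crNorm p L (valL p L α) (ext2 p L k α β f))

/-- Determinant of a 2×2 matrix. -/
noncomputable def det2 (m : Matrix (Fin 2) (Fin 2) ℚ_[p]) : ℚ_[p] :=
  m 0 0 * m 1 1 - m 0 1 * m 1 0

/-- The action of `g = (a b; c d) ∈ GL₂(ℚ_p)` on `B(α)`:
`(g·f)(z) = α^{-val(ad-bc)} (αp/β)^{val(-cz+a)} (-cz+a)^{k-2} f((dz-b)/(-cz+a))`,
the value at the pole `-cz+a = 0` being the one prescribed by the extension `f₂`. -/
noncomputable def gAct (k : ℕ) (α β : L) (m : Matrix (Fin 2) (Fin 2) ℚ_[p])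
    (f : ℚ_[p] → L) : ℚ_[p] → L := fun z =>
  if -(m 1 0) * z + m 0 0 = 0 then
    α ^ (-(det2 p m).valuation) * (α * (p : L) / β) ^ ((det2 p m / m 1 0).valuation) *
      (iotaL p L (det2 p m / m 1 0)) ^ (k - 2) * ext2 p L k α β f 0
  else
    α ^ (-(det2 p m).valuation) * (α * (p : L) / β) ^ ((-(m 1 0) * z + m 0 0).valuation) *
      (iotaL p L (-(m 1 0) * z + m 0 0)) ^ (k - 2) *
      f ((m 1 1 * z - m 0 1) / (-(m 1 0) * z + m 0 0))

/-- The monomial function `z ↦ z^j` on `ℚ_p`. -/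
noncomputable def monomialFun (j : ℕ) : ℚ_[p] → L := fun z => (iotaL p L z) ^ j

/-- The function `z ↦ (αp/β)^{val(z-a)} (z-a)^{k-2-j}` (extended by `0` at `z = a`). -/
noncomputable def specFun (k : ℕ) (α β : L) (a : ℚ_[p]) (j : ℕ) : ℚ_[p] → L := fun z =>
  if z = a then 0 else
    (α * (p : L) / β) ^ ((z - a).valuation) * (iotaL p L (z - a)) ^ (k - 2 - j)

/-- The generators of `L(α)` : the functions `z^j` and
`(αp/β)^{val(z-a)}(z-a)^{k-2-j}` for `0 ≤ j < val(α)` and `a ∈ ℚ_p`. -/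
def lGen (k : ℕ) (α β : L) : Set (ℚ_[p] → L) :=
  {f | ∃ j : ℕ, (j : ℝ) < valL p L α ∧
    (f = monomialFun p L j ∨ ∃ a : ℚ_[p], f = specFun p L k α β a j)}

/-- Membership in `L(α)`, the closure in `B(α)` of the span of the special
functions. -/
def MemLalpha (k : ℕ) (α β : L) (f : ℚ_[p] → L) : Prop :=
  MemB p L k α β f ∧ ∀ ε : ℝ, 0 < ε →
    ∃ g ∈ Submodule.span L (lGen p L k α β), bNorm p L k α β (f - g) < ε

/-- The quotient (semi)norm on `Π(V) = B(α)/L(α)`. -/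
noncomputable def qNorm (k : ℕ) (α β : L) (f : ℚ_[p] → L) : ℝ :=
  sInf {x : ℝ | ∃ g : ℚ_[p] → L, MemLalpha p L k α β g ∧ x = bNorm p L k α β (f - g)}

/-- `h : ℚ_p → L` is locally constant. -/
def LocConst (h : ℚ_[p] → L) : Prop :=
  ∀ x : ℚ_[p], ∃ n : ℕ, ∀ y : ℚ_[p], ‖y - x‖ ≤ (p : ℝ) ^ (-(n : ℤ)) → h y = h x

/-- `h` belongs to the smooth induced representation: `h` is locally constant and
`z ↦ (αp/β)^{val z} h(1/z)` extends to a locally constant function on `ℚ_p`. -/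
def IndCond (α β : L) (h : ℚ_[p] → L) : Prop :=
  LocConst p L h ∧ ∃ h' : ℚ_[p] → L, LocConst p L h' ∧
    ∀ z : ℚ_[p], z ≠ 0 → h' z = (α * (p : L) / β) ^ z.valuation * h z⁻¹

/-- The generators `z ↦ P(z) h(z)` of the locally algebraic representation `π(α)`. -/
def piGen (k : ℕ) (α β : L) : Set (ℚ_[p] → L) :=
  {f | ∃ (P : Polynomial L) (h : ℚ_[p] → L), P.natDegree ≤ k - 2 ∧ IndCond p L α β h ∧
    f = fun z => Polynomial.eval (iotaL p L z) P * h z}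

/-- The locally algebraic representation `π(α)`, as a subspace of functions
`ℚ_p → L`. -/
noncomputable def piRep (k : ℕ) (α β : L) : Submodule L (ℚ_[p] → L) :=
  Submodule.span L (piGen p L k α β)

/-- The standing hypotheses on `(k, α, β)` coming from an absolutely irreducible,
`φ`-semisimple crystalline representation: `k ≥ 2`, `α ≠ β`,
`0 < val(β) ≤ val(α)` and `val(α) + val(β) = k - 1`. -/
def Hyps (k : ℕ) (α β : L) : Prop :=
  2 ≤ k ∧ α ≠ β ∧ 0 < valL p L α ∧ 0 < valL p L β ∧
    valL p L α + valL p L β = (k : ℝ) - 1 ∧ valL p L β ≤ valL p L α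

/-- `Λ` is a `GL₂(ℚ_p)`-stable `𝒪_L`-lattice in `π(α)`: an `𝒪_L`-submodule of
`π(α)` generating it over `L`, containing no `L`-line and stable by the action. -/
def IsLatticeStable (k : ℕ) (α β : L) (Λ : Set (ℚ_[p] → L)) : Prop :=
  (∀ f ∈ Λ, f ∈ piRep p L k α β) ∧ ((0 : ℚ_[p] → L) ∈ Λ) ∧
  (∀ f ∈ Λ, ∀ g ∈ Λ, f + g ∈ Λ) ∧
  (∀ c : L, ‖c‖ ≤ 1 → ∀ f ∈ Λ, c • f ∈ Λ) ∧
  (∀ f ∈ piRep p L k α β, ∃ c : L, c ≠ 0 ∧ c • f ∈ Λ) ∧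
  (∀ f, f ∈ piRep p L k α β → f ≠ 0 → ¬ ∀ c : L, c • f ∈ Λ) ∧
  (∀ m : Matrix (Fin 2) (Fin 2) ℚ_[p], det2 p m ≠ 0 → ∀ f ∈ Λ, gAct p L k α β m f ∈ Λ)

section ShiftEstimate

open Polynomial fwdDiff_aux

variable {p : ℕ} [Fact p.Prime]
variable {L : Type} [NontriviallyNormedField L]

/-- Integral polynomials in the shift operator do not increase the sup norm. -/
lemma norm_aeval_shift_le [IsUltrametricDist L] {F : ℤ_[p] → L} {C : ℝ} (hF : ∀ z, ‖F z‖ ≤ C)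
    (P : ℤ[X]) (z : ℤ_[p]) :
    ‖aeval (shiftₗ ℤ_[p] L 1) P F z‖ ≤ C := by
  have hC : 0 ≤ C := (norm_nonneg _).trans (hF 0)
  rw [aeval_eq_sum_range, LinearMap.sum_apply, Finset.sum_apply]
  refine IsUltrametricDist.norm_sum_le_of_forall_le_of_nonneg hC fun i _ => ?_
  rw [LinearMap.smul_apply, Pi.smul_apply, shiftₗ_pow_apply, zsmul_eq_mul, norm_mul]
  calc _ ≤ 1 * C := mul_le_mul (IsUltrametricDist.norm_intCast_le_one L _) (hF _)
        (norm_nonneg _) zero_le_one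
    _ = C := one_mul C

/-- The freshman's dream: `(X - 1) ^ p ^ K` and `X ^ p ^ K - 1` agree modulo `p`. -/
lemma exists_X_sub_one_pow_eq (p : ℕ) [Fact p.Prime] (K : ℕ) : ∃ Q : ℤ[X],
    (X - 1 : ℤ[X]) ^ p ^ K = (X ^ p ^ K - 1) + (p : ℤ[X]) * Q := by
  have h : ((C (p : ℤ)) : ℤ[X]) ∣ (X - 1 : ℤ[X]) ^ p ^ K - (X ^ p ^ K - 1) := by
    rw [C_dvd_iff_dvd_coeff]
    intro i
    rw [← ZMod.intCast_zmod_eq_zero_iff_dvd _ p]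
    have h0 : ((X - 1 : ℤ[X]) ^ p ^ K - (X ^ p ^ K - 1)).map (Int.castRingHom (ZMod p)) = 0 := by
      simp [sub_pow_char_pow]
    rw [← coeff_zero (R := ZMod p) i, ← h0, coeff_map, eq_intCast]
  obtain ⟨Q, hQ⟩ := h
  exact ⟨Q, by rw [← sub_eq_iff_eq_add', hQ]; simp⟩

lemma aeval_shift_sub_one_pow (n e : ℕ) (F : ℤ_[p] → L) :
    aeval (shiftₗ ℤ_[p] L 1) ((X ^ n - 1 : ℤ[X]) ^ e) F = (fwdDiff (n : ℤ_[p]))^[e] F := by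
  have h : aeval (shiftₗ ℤ_[p] L 1) (X ^ n - 1 : ℤ[X]) = fwdDiffₗ ℤ_[p] L (n : ℤ_[p]) := by
    refine LinearMap.ext fun G => funext fun y => ?_
    simp only [map_sub, map_pow, aeval_X, map_one, LinearMap.sub_apply, Pi.sub_apply,
      shiftₗ_pow_apply, Module.End.one_apply, coe_fwdDiffₗ, fwdDiff, nsmul_eq_mul, mul_one]
  rw [map_pow, h, ← coe_fwdDiffₗ_pow]

lemma norm_fwdDiff_iter_le_of_le [IsUltrametricDist L] (N : ℕ) {F : ℤ_[p] → L} {C : ℝ}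
    (hF : ∀ z, ‖F z‖ ≤ C)
    (z : ℤ_[p]) : ‖(fwdDiff 1)^[N] F z‖ ≤ C := by
  have h1 := aeval_shift_sub_one_pow 1 N F
  rw [Nat.cast_one, pow_one] at h1
  rw [← h1]
  exact norm_aeval_shift_le hF _ z

lemma mahlerCoeff_eq_fwdDiff (f : ℤ_[p] → L) (n : ℕ) :
    mahlerCoeff p L f n = (fwdDiff 1)^[n] f 0 := by
  rw [fwdDiff_iter_eq_sum_shift, mahlerCoeff, ← Finset.sum_range_reflect]
  refine Finset.sum_congr rfl fun i hi => ?_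
  have hi' : i ≤ n := Nat.lt_succ_iff.mp (Finset.mem_range.mp hi)
  rw [show n + 1 - 1 - i = n - i by omega, Nat.choose_symm hi', Nat.sub_sub_self hi', zsmul_eq_mul]
  simp

variable [NormedAlgebra ℚ_[p] L]

lemma norm_iotaL (x : ℚ_[p]) : ‖iotaL p L x‖ = ‖x‖ := norm_algebraMap' L x

lemma norm_natCast_prime : ‖(p : L)‖ = (p : ℝ)⁻¹ := by
  have := norm_iotaL (L := L) (p : ℚ_[p])
  simpa [iotaL] using this

lemma norm_aeval_shift_pow_le [IsUltrametricDist L] (K M e : ℕ) {F : ℤ_[p] → L} {C : ℝ}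
    (hF : ∀ z, ‖F z‖ ≤ C)
    (he : aeval (shiftₗ ℤ_[p] L 1) ((X ^ p ^ K - 1 : ℤ[X]) ^ e) F = 0) (z : ℤ_[p]) :
    ‖aeval (shiftₗ ℤ_[p] L 1) ((X - 1 : ℤ[X]) ^ (p ^ K * M)) F z‖ ≤
      C * (p : ℝ) ^ ((e : ℤ) - M) := by
  have hp : (1 : ℝ) < p := mod_cast (Fact.out : p.Prime).one_lt
  have hC : 0 ≤ C := (norm_nonneg _).trans (hF 0)
  induction M generalizing e F z with
  | zero =>
    refine (norm_aeval_shift_le hF _ z).trans ?_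
    exact le_mul_of_one_le_right hC (one_le_zpow₀ hp.le (by simp))
  | succ M ih =>
    cases e with
    | zero =>
      have h0 : F = 0 := by simpa using he
      rw [h0, map_zero]
      simp only [Pi.zero_apply, norm_zero]
      positivity
    | succ e =>
      obtain ⟨Q, hQ⟩ := exists_X_sub_one_pow_eq p K
      have hsplit : (X - 1 : ℤ[X]) ^ (p ^ K * (M + 1)) =
          (X - 1) ^ (p ^ K * M) * (X ^ p ^ K - 1) + (p : ℤ[X]) * (Q * (X - 1) ^ (p ^ K * M)) := by
        rw [mul_add, pow_add, mul_one, hQ]; ring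
      rw [hsplit, map_add, LinearMap.add_apply, Pi.add_apply]
      refine (IsUltrametricDist.norm_add_le_max _ _).trans (max_le ?_ ?_)
      · rw [map_mul, Module.End.mul_apply]
        have := ih e (F := aeval (shiftₗ ℤ_[p] L 1) (X ^ p ^ K - 1 : ℤ[X]) F)
          (fun z => norm_aeval_shift_le hF _ z) (by
            rw [← Module.End.mul_apply, ← map_mul, ← pow_succ]; exact he) z
        refine this.trans (le_of_eq ?_)
        push_cast; congr 2; ring
      · have hb := norm_aeval_shift_le (F := aeval (shiftₗ ℤ_[p] L 1)
          ((X - 1 : ℤ[X]) ^ (p ^ K * M)) F) (ih (e + 1) hF he) Q z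
        rw [map_mul, map_mul, Module.End.mul_apply, Module.End.mul_apply, map_natCast,
          Module.End.natCast_apply, Pi.smul_apply, nsmul_eq_mul, norm_mul, norm_natCast_prime]
        calc _ ≤ (p : ℝ)⁻¹ * (C * (p : ℝ) ^ (((e + 1 : ℕ) : ℤ) - M)) := by gcongr
          _ = _ := by
            push_cast
            rw [show ((e : ℤ) + 1 - (M + 1)) = (e + 1 - M) - 1 by ring,
              zpow_sub_one₀ (by positivity)]
            ring

/-- A bounded function killed by the `e`-th power of the difference operator of step `p ^ K` has
exponentially decreasing iterated differences. -/
lemma norm_fwdDiff_iter_le [IsUltrametricDist L] (K e N : ℕ) {F : ℤ_[p] → L} {C : ℝ}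
    (hF : ∀ z, ‖F z‖ ≤ C)
    (he : (fwdDiff ((p ^ K : ℕ) : ℤ_[p]))^[e] F = 0) (z : ℤ_[p]) :
    ‖(fwdDiff 1)^[N] F z‖ ≤ C * (p : ℝ) ^ ((e : ℤ) - (N / p ^ K : ℕ)) := by
  have h1 := aeval_shift_sub_one_pow 1 N F
  rw [Nat.cast_one, pow_one] at h1
  rw [← h1, ← Nat.mod_add_div N (p ^ K), pow_add, map_mul, Module.End.mul_apply,
    Nat.mod_add_div]
  refine norm_aeval_shift_le (fun z => ?_) _ z
  exact norm_aeval_shift_pow_le K _ e hF (by rw [aeval_shift_sub_one_pow]; exact he) z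

/-- A polynomial times a function of period `h` is killed by high powers of the difference
operator of step `h`. -/
lemma fwdDiff_iter_periodic_mul_polynomial (P : L[X]) {w : ℤ_[p] → L} {h : ℤ_[p]} {e : ℕ}
    (hw : ∀ z, w (z + h) = w z) (he : P.natDegree < e) :
    (fwdDiff h)^[e] (fun z : ℤ_[p] => w z * P.eval (iotaL p L z)) = 0 := by
  funext y
  have hwk : ∀ n : ℕ, w (y + n • h) = w y := fun n => by
    induction n with
    | zero => simp
    | succ n ih => rw [succ_nsmul, ← add_assoc, hw, ih]
  set Q : L[X] := P.comp (C (iotaL p L h) * X + C (iotaL p L y)) with hQ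
  have hdeg : Q.natDegree < e := by
    refine lt_of_le_of_lt (natDegree_comp_le.trans ?_) he
    exact (Nat.mul_le_mul_left _ (natDegree_linear_le)).trans (by simp)
  have h0 := congrFun (Polynomial.fwdDiff_iter_eq_zero_of_degree_lt hdeg) 0
  rw [fwdDiff_iter_eq_sum_shift] at h0 ⊢
  rw [Pi.zero_apply] at h0 ⊢
  rw [← mul_zero (w y), ← h0, Finset.mul_sum]
  refine Finset.sum_congr rfl fun i _ => ?_
  rw [hwk, mul_smul_comm, hQ]
  simp only [iotaL, nsmul_eq_mul, PadicInt.coe_add, PadicInt.coe_mul, PadicInt.coe_natCast,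
    map_add, map_mul, map_natCast, eval_comp, eval_add, eval_mul, eval_C, eval_X, zero_add, mul_one]
  rw [add_comm, mul_comm (i : L)]

end ShiftEstimate

section Mahler

open Polynomial

variable {p : ℕ} [Fact p.Prime]

lemma coe_mahler_eq_binomQ (n : ℕ) (z : ℤ_[p]) : ((mahler n z : ℤ_[p]) : ℚ_[p]) = binomQ p z n := by
  have h := congrArg (fun x : ℤ_[p] => (x : ℚ_[p]))
    (Ring.descPochhammer_eq_factorial_smul_choose z n)
  rw [binomQ, eq_div_iff (by exact_mod_cast n.factorial_ne_zero), mahler_apply]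
  simp only [nsmul_eq_mul, PadicInt.coe_mul, PadicInt.coe_natCast] at h
  rw [mul_comm, ← h, ← aeval_eq_smeval, ← eval_map_algebraMap, descPochhammer_map,
    descPochhammer_eval_eq_prod_range]
  exact (map_prod PadicInt.Coe.ringHom _ _).trans
    (Finset.prod_congr rfl fun i _ => by
      rw [map_sub, map_natCast]; rfl)

variable {L : Type} [NontriviallyNormedField L] [NormedAlgebra ℚ_[p] L] [IsUltrametricDist L]
  [CompleteSpace L]

lemma hasSum_mahlerCoeff {f : ℤ_[p] → L} (hf : Continuous f) (z : ℤ_[p]) :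
    HasSum (fun n : ℕ => mahlerCoeff p L f n * iotaL p L (binomQ p z n)) (f z) := by
  let _ : Module ℤ_[p] L := Module.compHom L (algebraMap ℤ_[p] ℚ_[p])
  have hsmul : ∀ (x : ℤ_[p]) (y : L), x • y = iotaL p L x * y := fun x y =>
    Algebra.smul_def (x : ℚ_[p]) y
  have : IsBoundedSMul ℤ_[p] L := IsBoundedSMul.of_norm_smul_le fun x y => by
    rw [hsmul, norm_mul, norm_iotaL, PadicInt.norm_def]
  have h := ContinuousMap.hasSum_apply (PadicInt.hasSum_mahler (⟨f, hf⟩ : C(ℤ_[p], L))) z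
  have hterm : ∀ n : ℕ, mahlerCoeff p L f n * iotaL p L (binomQ p z n) =
      PadicInt.mahlerTerm ((fwdDiff 1)^[n] f 0) n z := fun n => by
    rw [PadicInt.mahlerTerm_apply, hsmul, coe_mahler_eq_binomQ, mahlerCoeff_eq_fwdDiff, mul_comm]
  simp_rw [hterm]
  exact h

end Mahler

section Criterion

open Polynomial

lemma tendsto_rpow_mul_zero_of_le_max {r s C : ℝ} {n : ℕ} (hq : (1 : ℝ) < n) (hr : 0 < r)
    (hrs : r < s) (hC : 0 ≤ C) (e : ℕ) {b : ℕ → ℝ} (hb0 : ∀ N, 0 ≤ b N)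
    (hb : ∀ N K : ℕ, b N ≤
      max (C * (n : ℝ) ^ ((e : ℤ) - (N / n ^ K : ℕ))) (C * (n : ℝ) ^ (-(K * s)))) :
    Tendsto (fun N : ℕ => (N : ℝ) ^ r * b N) atTop (𝓝 0) := by
  obtain ⟨q, hn⟩ : ∃ q : ℝ, (n : ℝ) = q := ⟨_, rfl⟩
  simp only [hn] at hq hb
  have hq0 : 0 < q := by linarith
  obtain ⟨t, ht1, ht2⟩ : ∃ t, r / s < t ∧ t < 1 :=
    exists_between ((div_lt_one (hr.trans hrs)).mpr hrs)
  have hs : 0 < s := hr.trans hrs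
  have ht0 : 0 < t := (div_pos hr hs).trans ht1
  have hts : 0 < t * s - r := by rw [div_lt_iff₀ hs] at ht1; linarith
  have hcast : Tendsto (fun N : ℕ => (N : ℝ)) atTop atTop := tendsto_natCast_atTop_atTop
  have lim1 : Tendsto (fun N : ℕ => (N : ℝ) ^ (-(t * s - r))) atTop (𝓝 0) :=
    (tendsto_rpow_neg_atTop hts).comp hcast
  have lim2 : Tendsto (fun N : ℕ => ((N : ℝ) ^ (1 - t)) ^ (r / (1 - t)) *
      Real.exp (-Real.log q * (N : ℝ) ^ (1 - t))) atTop (𝓝 0) :=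
    (tendsto_rpow_mul_exp_neg_mul_atTop_nhds_zero (r / (1 - t)) _ (Real.log_pos hq)).comp
      ((tendsto_rpow_atTop (by linarith : 0 < 1 - t)).comp hcast)
  have lim := (lim2.const_mul (C * q ^ ((e : ℝ) + 1))).add (lim1.const_mul (C * q ^ s))
  rw [mul_zero, mul_zero, add_zero] at lim
  refine squeeze_zero' (Eventually.of_forall fun N => mul_nonneg (by positivity) (hb0 N)) ?_ lim
  filter_upwards [eventually_ge_atTop 1] with N hN
  have hN0 : (0 : ℝ) < N := by exact_mod_cast hN
  have hN1 : (1 : ℝ) ≤ N := by exact_mod_cast hN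
  set x : ℝ := t * Real.logb q N with hx
  have hx0 : 0 ≤ x := mul_nonneg ht0.le (Real.logb_nonneg hq hN1)
  have hqx : q ^ x = (N : ℝ) ^ t := by
    rw [hx, mul_comm, Real.rpow_mul hq0.le, Real.rpow_logb hq0 hq.ne' hN0]
  set K := ⌊x⌋₊ with hK
  have hKle : (K : ℝ) ≤ x := Nat.floor_le hx0
  have hKlt : x < K + 1 := Nat.lt_floor_add_one x
  have hnK : ((n ^ K : ℕ) : ℝ) ≤ (N : ℝ) ^ t := by
    rw [Nat.cast_pow, hn, ← Real.rpow_natCast, ← hqx]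
    exact Real.rpow_le_rpow_of_exponent_le hq.le hKle
  have hnpos : (0 : ℝ) < ((n ^ K : ℕ) : ℝ) := by rw [Nat.cast_pow, hn]; positivity
  have hdiv : (N : ℝ) ^ (1 - t) - 1 ≤ ((N / n ^ K : ℕ) : ℝ) := by
    have h1 : (N : ℝ) / ((n ^ K : ℕ) : ℝ) < ((N / n ^ K : ℕ) : ℝ) + 1 := by
      rw [← Nat.floor_div_eq_div (K := ℝ)]
      exact Nat.lt_floor_add_one _
    have h2 : (N : ℝ) ^ (1 - t) ≤ (N : ℝ) / ((n ^ K : ℕ) : ℝ) := by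
      rw [Real.rpow_sub hN0, Real.rpow_one]
      gcongr
    linarith
  have e1 : C * q ^ ((e : ℤ) - (N / n ^ K : ℕ)) ≤
      C * q ^ ((e : ℝ) + 1) * Real.exp (-Real.log q * (N : ℝ) ^ (1 - t)) := by
    rw [← Real.rpow_intCast, neg_mul, ← mul_neg, ← Real.rpow_def_of_pos hq0, mul_assoc,
      ← Real.rpow_add hq0]
    refine mul_le_mul_of_nonneg_left (Real.rpow_le_rpow_of_exponent_le hq.le ?_) hC
    rw [Int.cast_sub, Int.cast_natCast, Int.cast_natCast]
    linarith
  have e2 : C * q ^ (-(K * s)) ≤ C * q ^ s * (N : ℝ) ^ (-(t * s)) := by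
    have : (N : ℝ) ^ (-(t * s)) = q ^ (-(x * s)) := by
      rw [← mul_neg, ← mul_neg, Real.rpow_mul hq0.le, hqx, ← Real.rpow_mul hN0.le]
    rw [this, mul_assoc, ← Real.rpow_add hq0]
    refine mul_le_mul_of_nonneg_left (Real.rpow_le_rpow_of_exponent_le hq.le ?_) hC
    nlinarith
  have hNr : (0 : ℝ) ≤ (N : ℝ) ^ r := by positivity
  calc (N : ℝ) ^ r * b N
      ≤ (N : ℝ) ^ r * (C * q ^ ((e : ℝ) + 1) * Real.exp (-Real.log q * (N : ℝ) ^ (1 - t)) +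
          C * q ^ s * (N : ℝ) ^ (-(t * s))) := by
        refine mul_le_mul_of_nonneg_left ((hb N K).trans (max_le ?_ ?_)) hNr
        · exact e1.trans (le_add_of_nonneg_right (by positivity))
        · exact e2.trans (le_add_of_nonneg_left (by positivity))
    _ = _ := by
        rw [← Real.rpow_mul hN0.le, mul_div_cancel₀ r (by linarith : (1 - t) ≠ 0),
          show -(t * s - r) = r + -(t * s) by ring, Real.rpow_add hN0]
        ring

variable {p : ℕ} [Fact p.Prime]
variable {L : Type} [NontriviallyNormedField L] [NormedAlgebra ℚ_[p] L]

lemma continuous_eval_iotaL (P : L[X]) : Continuous fun z : ℤ_[p] => P.eval (iotaL p L z) :=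
  P.continuous.comp ((algebraMapCLM ℚ_[p] L).continuous.comp continuous_subtype_val)

variable [IsUltrametricDist L] [CompleteSpace L]

lemma isCr_eval_polynomial (r : ℝ) (P : L[X]) :
    IsCr p L r fun z : ℤ_[p] => P.eval (iotaL p L z) := by
  refine ⟨?_, hasSum_mahlerCoeff (continuous_eval_iotaL P)⟩
  refine tendsto_const_nhds.congr' ?_
  filter_upwards [eventually_gt_atTop P.natDegree] with n hn
  have h := fwdDiff_iter_periodic_mul_polynomial (p := p) P (w := fun _ => 1) (h := 1)
    (fun _ => rfl) hn
  simp only [one_mul] at h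
  rw [mahlerCoeff_eq_fwdDiff, h]
  simp

/-- A function that is well approximated by locally polynomial functions of bounded degree is of
class `C^r`. -/
lemma isCr_of_approx {r s C : ℝ} (hr : 0 < r) (hrs : r < s) (P : L[X]) {g : ℤ_[p] → L}
    (w : ℕ → ℤ_[p] → L)
    (hw : ∀ (K : ℕ) z z', ‖z - z'‖ ≤ (p : ℝ) ^ (-(K : ℤ)) → w K z = w K z')
    (hb : ∀ K z, ‖w K z * P.eval (iotaL p L z)‖ ≤ C)
    (hg : ∀ K z, ‖g z - w K z * P.eval (iotaL p L z)‖ ≤ C * (p : ℝ) ^ (-(K * s))) :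
    IsCr p L r g := by
  have hp : (1 : ℝ) < p := mod_cast (Fact.out : p.Prime).one_lt
  have hp0 : (0 : ℝ) < p := by linarith
  have hC : 0 ≤ C := (norm_nonneg _).trans (hb 0 0)
  constructor
  · refine tendsto_rpow_mul_zero_of_le_max hp hr hrs hC (P.natDegree + 1) (fun _ => norm_nonneg _)
      fun N K => ?_
    rw [mahlerCoeff_eq_fwdDiff]
    set F : ℤ_[p] → L := fun z => w K z * P.eval (iotaL p L z) with hF
    have hsplit : g = F + (g - F) := by abel
    rw [hsplit, fwdDiff_iter_add, Pi.add_apply]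
    refine (IsUltrametricDist.norm_add_le_max _ _).trans (max_le_max ?_ ?_)
    · refine norm_fwdDiff_iter_le K (P.natDegree + 1) N (hb K) ?_ 0
      refine fwdDiff_iter_periodic_mul_polynomial P (fun z => hw K _ _ ?_) (Nat.lt_succ_self _)
      simp
    · exact norm_fwdDiff_iter_le_of_le N (hg K) 0
  · refine hasSum_mahlerCoeff ?_
    have hunif : TendstoUniformly (fun K (z : ℤ_[p]) => w K z * P.eval (iotaL p L z)) g atTop := by
      rw [Metric.tendstoUniformly_iff]
      intro ε hε
      have hlim : Tendsto (fun K : ℕ => C * (p : ℝ) ^ (-(K * s))) atTop (𝓝 0) := by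
        have h1 : Tendsto (fun K : ℕ => ((p : ℝ) ^ (-s)) ^ K) atTop (𝓝 0) :=
          tendsto_pow_atTop_nhds_zero_of_lt_one (by positivity)
            (Real.rpow_lt_one_of_one_lt_of_neg hp (by linarith))
        have h2 := h1.const_mul C
        rw [mul_zero] at h2
        refine h2.congr fun K => ?_
        rw [← Real.rpow_natCast, ← Real.rpow_mul hp0.le]
        congr 2
        ring
      filter_upwards [hlim.eventually_lt_const hε] with K hK z
      rw [dist_eq_norm]
      exact (hg K z).trans_lt hK
    refine hunif.continuous (Frequently.of_forall fun K => ?_)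
    refine Continuous.mul (IsLocallyConstant.continuous ?_) (continuous_eval_iotaL P)
    rw [IsLocallyConstant.iff_eventually_eq]
    intro z
    filter_upwards [Metric.closedBall_mem_nhds z (by positivity : 0 < (p : ℝ) ^ (-(K : ℤ)))]
      with y hy
    exact hw K _ _ (by simpa [dist_eq_norm] using hy)

end Criterion

section Twisted

open Polynomial

variable {p : ℕ} [Fact p.Prime]
variable {L : Type} [NontriviallyNormedField L] [NormedAlgebra ℚ_[p] L]

lemma valuation_eq_of_norm_eq {x y : ℚ_[p]} (hx : x ≠ 0) (h : ‖x‖ = ‖y‖) :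
    x.valuation = y.valuation := by
  have hp : (1 : ℝ) < p := mod_cast (Fact.out : p.Prime).one_lt
  have hy : y ≠ 0 := norm_ne_zero_iff.mp (h ▸ norm_ne_zero_iff.mpr hx)
  rw [Padic.norm_eq_zpow_neg_valuation hx, Padic.norm_eq_zpow_neg_valuation hy] at h
  exact neg_injective (zpow_right_injective₀ (by linarith) hp.ne' h)

lemma norm_zpow_valuation_mul_pow {c : L} (hc : c ≠ 0) (m : ℕ) {x : ℚ_[p]} (hx : x ≠ 0) :
    ‖c ^ x.valuation * iotaL p L x ^ m‖ = (p : ℝ) ^ (-(x.valuation * (valL p L c + m))) := by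
  have hp : (1 : ℝ) < p := mod_cast (Fact.out : p.Prime).one_lt
  have hp0 : (0 : ℝ) < p := by linarith
  have hcn : ‖c‖ = (p : ℝ) ^ (-valL p L c) := by
    rw [valL, neg_neg, Real.rpow_logb hp0 hp.ne' (norm_pos_iff.mpr hc)]
  rw [norm_mul, norm_zpow, norm_pow, norm_iotaL, Padic.norm_eq_zpow_neg_valuation hx, hcn,
    ← Real.rpow_intCast, ← Real.rpow_intCast, ← Real.rpow_natCast, ← Real.rpow_mul hp0.le,
    ← Real.rpow_mul hp0.le, ← Real.rpow_add hp0]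
  congr 1
  push_cast
  ring

variable [IsUltrametricDist L] [CompleteSpace L]

lemma isCr_twisted {c : L} (hc : c ≠ 0) {r : ℝ} (hr : 0 < r) (u : L) (b : ℤ_[p]) (i m : ℕ)
    (hs : r < valL p L c + m) :
    IsCr p L r fun z : ℤ_[p] => u * iotaL p L z ^ i *
      (if z = b then 0 else c ^ ((z : ℚ_[p]) - b).valuation * iotaL p L ((z : ℚ_[p]) - b) ^ m) := by
  have hp : (1 : ℝ) < p := mod_cast (Fact.out : p.Prime).one_lt
  have hp0 : (0 : ℝ) < p := by linarith
  have hs0 : 0 < valL p L c + m := hr.trans hs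
  have hne : ∀ {z : ℤ_[p]}, z ≠ b → (z : ℚ_[p]) - b ≠ 0 := fun {z} hz =>
    sub_ne_zero.mpr (Subtype.coe_injective.ne hz)
  have hval : ∀ {z : ℤ_[p]} {K : ℕ}, z ≠ b → ‖z - b‖ ≤ (p : ℝ) ^ (-(K : ℤ)) →
      (K : ℤ) ≤ ((z : ℚ_[p]) - b).valuation := fun {z K} hz h => by
    rw [PadicInt.norm_def, PadicInt.coe_sub, Padic.norm_eq_zpow_neg_valuation (hne hz),
      zpow_le_zpow_iff_right₀ hp] at h
    linarith
  have hval0 : ∀ {z : ℤ_[p]}, z ≠ b → 0 ≤ ((z : ℚ_[p]) - b).valuation := fun {z} hz => by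
    have := hval (K := 0) hz (by simpa using PadicInt.norm_le_one (z - b))
    simpa using this
  have hbound : ∀ (z : ℤ_[p]) (y : L) (t : ℝ), ‖y‖ ≤ t → ‖u * iotaL p L z ^ i * y‖ ≤ ‖u‖ * t :=
    fun z y t hy => by
      rw [norm_mul, norm_mul, norm_pow, norm_iotaL]
      refine mul_le_mul ?_ hy (norm_nonneg _) (norm_nonneg _)
      exact mul_le_of_le_one_right (norm_nonneg _)
        (pow_le_one₀ (norm_nonneg _) (PadicInt.norm_le_one z))
  set P : L[X] := C u * X ^ i * (X - C (iotaL p L b)) ^ m with hP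
  have hPe : ∀ (z : ℤ_[p]) (x : L), x * P.eval (iotaL p L z) =
      u * iotaL p L z ^ i * (x * iotaL p L ((z : ℚ_[p]) - b) ^ m) := fun z x => by
    simp only [hP, iotaL, eval_mul, eval_C, eval_pow, eval_X, eval_sub, map_sub]
    ring
  refine isCr_of_approx (C := ‖u‖) hr hs P
    (fun K z => if ‖z - b‖ ≤ (p : ℝ) ^ (-(K : ℤ)) then 0 else c ^ ((z : ℚ_[p]) - b).valuation)
    (fun K z z' hz => ?_) (fun K z => ?_) (fun K z => ?_)
  · have hsub : z - b - (z' - b) = z - z' := by ring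
    have hiff : ‖z - b‖ ≤ (p : ℝ) ^ (-(K : ℤ)) ↔ ‖z' - b‖ ≤ (p : ℝ) ^ (-(K : ℤ)) := by
      constructor <;> intro h
      · rw [show z' - b = (z - b) + (z' - z) by ring]
        exact (IsUltrametricDist.norm_add_le_max _ _).trans (max_le h (norm_sub_rev z z' ▸ hz))
      · rw [show z - b = (z' - b) + (z - z') by ring]
        exact (IsUltrametricDist.norm_add_le_max _ _).trans (max_le h hz)
    by_cases h : ‖z - b‖ ≤ (p : ℝ) ^ (-(K : ℤ))
    · rw [if_pos h, if_pos (hiff.mp h)]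
    · rw [if_neg h, if_neg (mt hiff.mpr h)]
      have hzb : z ≠ b := fun e => h (by simp [e])
      congr 1
      refine valuation_eq_of_norm_eq (hne hzb) (Padic.norm_eq_of_norm_sub_lt_left ?_)
      rw [← PadicInt.coe_sub, ← PadicInt.coe_sub, ← PadicInt.coe_sub, ← PadicInt.norm_def,
        ← PadicInt.norm_def, hsub]
      exact hz.trans_lt (not_le.mp h)
  · rw [hPe, ← mul_one ‖u‖]
    refine hbound z _ 1 ?_
    split_ifs with h
    · simp
    · have hzb : z ≠ b := fun e => h (by simp [e])
      rw [norm_zpow_valuation_mul_pow hc m (hne hzb)]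
      refine Real.rpow_le_one_of_one_le_of_nonpos hp.le (neg_nonpos.mpr (mul_nonneg ?_ hs0.le))
      exact_mod_cast hval0 hzb
  · rw [hPe, ← mul_sub]
    refine hbound z _ _ ?_
    by_cases h : ‖z - b‖ ≤ (p : ℝ) ^ (-(K : ℤ))
    · rw [if_pos h, zero_mul, sub_zero]
      split_ifs with hzb
      · rw [norm_zero]; positivity
      · rw [norm_zpow_valuation_mul_pow hc m (hne hzb)]
        refine Real.rpow_le_rpow_of_exponent_le hp.le (neg_le_neg ?_)
        refine mul_le_mul_of_nonneg_right ?_ hs0.le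
        exact_mod_cast hval hzb h
    · have hzb : z ≠ b := fun e => h (by simp [e])
      rw [if_neg h, if_neg hzb, sub_self, norm_zero]
      positivity

variable {k j : ℕ} {α β : L}

lemma memB_monomialFun (hc : α * (p : L) / β ≠ 0) (hr : 0 < valL p L α)
    (hs : valL p L α < valL p L (α * (p : L) / β) + (k - 2 - j : ℕ)) (hjk : j ≤ k - 2) :
    MemB p L k α β (monomialFun p L j) := by
  constructor
  · convert isCr_eval_polynomial (p := p) (valL p L α) ((C (p : L) * X) ^ j) using 2 with z
    simp [monomialFun, iotaL]
  · refine ⟨_, isCr_twisted hc hr 1 0 0 (k - 2 - j) hs, fun z hz => ?_⟩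
    have hz' : (algebraMap ℚ_[p] L z) ≠ 0 := by simpa using hz
    rw [if_neg hz]
    simp only [monomialFun, iotaL, PadicInt.coe_zero, sub_zero, pow_zero, one_mul, map_inv₀, inv_pow]
    rw [mul_assoc, pow_sub₀ _ hz' hjk]

lemma isCr_specFun_mul (hc : α * (p : L) / β ≠ 0) (hr : 0 < valL p L α)
    (hs : valL p L α < valL p L (α * (p : L) / β) + (k - 2 - j : ℕ)) (a : ℚ_[p]) :
    IsCr p L (valL p L α) fun z : ℤ_[p] => specFun p L k α β a j ((p : ℚ_[p]) * (z : ℚ_[p])) := by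
  have hpQ : (p : ℚ_[p]) ≠ 0 := by exact_mod_cast (Fact.out : p.Prime).ne_zero
  rcases lt_or_ge ‖a‖ 1 with ha | ha
  · obtain ⟨b, rfl⟩ : ∃ b : ℤ_[p], a = p * (b : ℚ_[p]) := by
      obtain ⟨b, hb⟩ := (PadicInt.norm_lt_one_iff_dvd (⟨a, ha.le⟩ : ℤ_[p])).mp ha
      exact ⟨b, by simpa using congrArg (fun x : ℤ_[p] => (x : ℚ_[p])) hb⟩
    convert isCr_twisted hc hr (α * (p : L) / β * (p : L) ^ (k - 2 - j)) b 0 (k - 2 - j) hs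
      using 2 with z
    by_cases hz : z = b
    · simp [specFun, hz]
    · have hz' : (z : ℚ_[p]) - b ≠ 0 := sub_ne_zero.mpr (Subtype.coe_injective.ne hz)
      have hz'' : (p : ℚ_[p]) * z ≠ p * b := fun e => hz' (sub_eq_zero.mpr (mul_left_cancel₀ hpQ e))
      rw [specFun, if_neg hz'', if_neg hz, ← mul_sub, Padic.valuation_mul hpQ hz',
        Padic.valuation_p, zpow_add₀ hc, zpow_one, iotaL, map_mul, map_natCast, mul_pow]
      ring
  · convert isCr_eval_polynomial (p := p) (valL p L α) (C ((α * (p : L) / β) ^ a.valuation) *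
      (C (p : L) * X - C (iotaL p L a)) ^ (k - 2 - j)) using 2 with z
    have hlt : ‖(p : ℚ_[p]) * z‖ < ‖a‖ := by
      refine lt_of_lt_of_le ?_ ha
      rw [norm_mul]
      exact mul_lt_one_of_nonneg_of_lt_one_left (norm_nonneg _) Padic.norm_p_lt_one
        (PadicInt.norm_le_one z)
    have hne : (p : ℚ_[p]) * z ≠ a := fun e => hlt.ne (by rw [e])
    have hv : ((p : ℚ_[p]) * z - a).valuation = a.valuation := by
      refine valuation_eq_of_norm_eq (sub_ne_zero.mpr hne) ?_
      rw [← norm_neg a]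
      refine Padic.norm_eq_of_norm_sub_lt_right ?_
      simpa using hlt
    rw [specFun, if_neg hne, hv]
    simp [iotaL]

lemma exists_ext2_specFun (hc : α * (p : L) / β ≠ 0) (hr : 0 < valL p L α)
    (hs : valL p L α < valL p L (α * (p : L) / β) + (k - 2 - j : ℕ)) (hjk : j ≤ k - 2)
    (a : ℚ_[p]) : ∃ g : ℤ_[p] → L, Ext2 p L k α β (specFun p L k α β a j) g := by
  obtain ⟨m, hm⟩ := Nat.exists_eq_add_of_le hjk
  have hm' : k - 2 - j = m := by omega
  rw [hm'] at hs
  rcases lt_or_ge ‖a‖ 1 with ha | ha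
  · refine ⟨_, isCr_eval_polynomial _ (X ^ j * (1 - C (iotaL p L a) * X) ^ m), fun z hz => ?_⟩
    have hz0 : (z : ℚ_[p]) ≠ 0 := by simpa using hz
    have hz' : (algebraMap ℚ_[p] L z) ≠ 0 := by simpa using hz
    have hlt : ‖a‖ < ‖(z : ℚ_[p])⁻¹‖ := by
      refine ha.trans_le ?_
      rw [norm_inv]
      exact (one_le_inv₀ (norm_pos_iff.mpr hz0)).mpr (PadicInt.norm_le_one z)
    have hne : (z : ℚ_[p])⁻¹ ≠ a := fun e => hlt.ne (by rw [e])
    have hv : ((z : ℚ_[p])⁻¹ - a).valuation = -(z : ℚ_[p]).valuation := by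
      rw [← Padic.valuation_inv]
      refine valuation_eq_of_norm_eq (sub_ne_zero.mpr hne) ?_
      refine Padic.norm_eq_of_norm_sub_lt_right ?_
      simpa using hlt
    rw [specFun, if_neg hne, hv, zpow_neg, hm', hm, pow_add]
    have hcv := zpow_ne_zero (z : ℚ_[p]).valuation hc
    have hlin : 1 - iotaL p L a * iotaL p L z = iotaL p L z * iotaL p L ((z : ℚ_[p])⁻¹ - a) := by
      simp only [iotaL, map_sub, map_inv₀]
      field_simp
    simp only [eval_mul, eval_pow, eval_X, eval_sub, eval_one, eval_C]
    rw [hlin, mul_pow]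
    field_simp
  · have ha0 : a ≠ 0 := norm_pos_iff.mp (zero_lt_one.trans_le ha)
    have hb : ‖a⁻¹‖ ≤ 1 := by rw [norm_inv]; exact inv_le_one_of_one_le₀ ha
    refine ⟨_, isCr_twisted hc hr ((α * (p : L) / β) ^ a.valuation * (iotaL p L (-a)) ^ m)
      ⟨a⁻¹, hb⟩ j m hs, fun z hz => ?_⟩
    have hz0 : (z : ℚ_[p]) ≠ 0 := by simpa using hz
    have hz' : (algebraMap ℚ_[p] L z) ≠ 0 := by simpa using hz
    have hiff : (z : ℚ_[p])⁻¹ = a ↔ z = ⟨a⁻¹, hb⟩ := by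
      rw [inv_eq_iff_eq_inv]
      exact ⟨fun e => Subtype.ext e, fun e => congrArg Subtype.val e⟩
    rw [specFun]
    by_cases hza : z = ⟨a⁻¹, hb⟩
    · rw [if_pos hza, if_pos (hiff.mpr hza), mul_zero, mul_zero]
    · rw [if_neg hza, if_neg (mt hiff.mp hza)]
      have hsub : (z : ℚ_[p]) - a⁻¹ ≠ 0 :=
        sub_ne_zero.mpr fun e => hza (hiff.mp (inv_eq_iff_eq_inv.mpr e))
      have hfac : (z : ℚ_[p])⁻¹ - a = -a * ((z : ℚ_[p]) - a⁻¹) * (z : ℚ_[p])⁻¹ := by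
        field_simp
        ring
      have hva : (-a).valuation = a.valuation :=
        valuation_eq_of_norm_eq (neg_ne_zero.mpr ha0) (norm_neg a)
      rw [hfac, Padic.valuation_mul (mul_ne_zero (neg_ne_zero.mpr ha0) hsub) (inv_ne_zero hz0),
        Padic.valuation_mul (neg_ne_zero.mpr ha0) hsub, Padic.valuation_inv, hva, zpow_add₀ hc,
        zpow_add₀ hc, zpow_neg, hm', hm, pow_add]
      have hcv := zpow_ne_zero (z : ℚ_[p]).valuation hc
      simp only [iotaL, map_mul, map_inv₀, mul_pow, inv_pow]
      field_simp

end Twisted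

/-- For every integer `0 ≤ j < val(α)` and every `a ∈ ℚ_p`, the functions
`z ↦ z^j` and `z ↦ (αp/β)^{val(z-a)} (z-a)^{k-2-j}` (extended by `0` at `z = a`)
belong to `B(α)`. -/
theorem statement6 (p : ℕ) [Fact p.Prime] (L : Type) [NontriviallyNormedField L]
    [NormedAlgebra ℚ_[p] L] [FiniteDimensional ℚ_[p] L] [IsUltrametricDist L]
    (k : ℕ) (α β : L) (h : Hyps p L k α β)
    (j : ℕ) (hj : (j : ℝ) < valL p L α) (a : ℚ_[p]) :
    MemB p L k α β (monomialFun p L j) ∧ MemB p L k α β (specFun p L k α β a j) := by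
  have : CompleteSpace L := FiniteDimensional.complete ℚ_[p] L
  obtain ⟨hk, -, hα, hβ, hsum, -⟩ := h
  have hp : (1 : ℝ) < p := mod_cast (Fact.out : p.Prime).one_lt
  have hα0 : α ≠ 0 := by rintro rfl; simp [valL] at hα
  have hβ0 : β ≠ 0 := by rintro rfl; simp [valL] at hβ
  have hp0 : (p : L) ≠ 0 := by
    rw [← norm_ne_zero_iff, norm_natCast_prime]
    positivity
  have hc : α * (p : L) / β ≠ 0 := div_ne_zero (mul_ne_zero hα0 hp0) hβ0
  have hjk : j ≤ k - 2 := by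
    have : (j : ℝ) + 1 < k := by linarith
    have : j + 1 < k := by exact_mod_cast this
    omega
  have hvc : valL p L (α * (p : L) / β) = valL p L α + 1 - valL p L β := by
    have h1 : Real.logb p (p : ℝ)⁻¹ = -1 := by
      rw [Real.logb_inv, Real.logb_self_eq_one hp]
    simp only [valL]
    rw [norm_div, norm_mul, norm_natCast_prime, Real.logb_div (by positivity) (by positivity),
      Real.logb_mul (by positivity) (by positivity), h1]
    ring
  have hs : valL p L α < valL p L (α * (p : L) / β) + (k - 2 - j : ℕ) := by
    rw [hvc, Nat.cast_sub hjk, Nat.cast_sub hk]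
    push_cast
    linarith
  exact ⟨memB_monomialFun hc hα hs hjk, isCr_specFun_mul hc hα hs a,
    exists_ext2_specFun hc hα hs hjk a⟩

end Paper

end
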